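/- arXiv:2507.04427 — 3 statements merged into one kernel-verified Lean document; each statement's English description precedes it below -/
import Mathlib

section
/- Let θ ∈ [-1,0) and a ≥ -1/θ. Then there exists ε > 0 such that for all complex z with 0 < |z| < ε one has ∑_{n=0}^∞ p_n^a(θ) z^n = (θa+1)/(θ(1+a)) + [E(θ, -z/(θ(1+a))) − E(θ, -z/(1+a))] / [z · E(θ, -z/(1+a))]. -/
open MeasureTheory Set

/-- Persistence probability `p_n^a(θ)` for the MA(1) process with uniform
innovations on `[-a,1]`. -/
noncomputable def persprob (a θ : ℝ) : ℕ → ℝ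
  | 0 => 1
  | n + 1 =>
    (volume {x : Fin (n + 2) → ℝ |
        (∀ i, x i ∈ Icc (-a) 1) ∧
        ∀ i : Fin (n + 1), θ * x i.castSucc ≤ x i.succ}).toReal / (1 + a) ^ (n + 2)

/-- The deformed exponential function `E(r,z) = ∑ r^{n(n-1)/2} z^n / n!`. -/
noncomputable def defExp (r z : ℂ) : ℂ :=
  ∑' n : ℕ, r ^ (n * (n - 1) / 2) * z ^ n / (n.factorial : ℂ)

/-- The iterated integrals `q₀ = 1`, `qₙ₊₁(b) = ∫_b^1 qₙ(θ y) dy`. -/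
noncomputable def chainIntegral (θ : ℝ) : ℕ → ℝ → ℝ
  | 0, _ => 1
  | n + 1, b => ∫ y in b..1, chainIntegral θ n (θ * y)

/-- The `n`-th coefficient of `w ↦ E(θ, -w)`. -/
noncomputable def defExpCoeff (θ : ℝ) (n : ℕ) : ℝ :=
  (-1) ^ n * θ ^ (n * (n - 1) / 2) / n.factorial

/-- Vectors in `[-a,1]^{n+1}` satisfying the persistence constraints whose first entry is at
least `b`. -/
def chainSet (a θ : ℝ) (n : ℕ) (b : ℝ) : Set (Fin (n + 1) → ℝ) :=
  {x | b ≤ x 0 ∧ (∀ i, x i ∈ Icc (-a) 1) ∧ ∀ i : Fin n, θ * x i.castSucc ≤ x i.succ}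

lemma continuous_chainIntegral (θ : ℝ) (n : ℕ) : Continuous (chainIntegral θ n) := by
  induction n with
  | zero => exact continuous_const
  | succ n ih =>
    have h : chainIntegral θ (n + 1) = fun b => -∫ y in (1 : ℝ)..b, chainIntegral θ n (θ * y) := by
      funext b
      rw [chainIntegral, intervalIntegral.integral_symm]
    rw [h]
    have hc : Continuous fun y => chainIntegral θ n (θ * y) := by fun_prop
    exact (intervalIntegral.continuous_primitive
      (fun _ _ => hc.intervalIntegrable _ _) 1).neg

lemma defExpCoeff_zero (θ : ℝ) : defExpCoeff θ 0 = 1 := by simp [defExpCoeff]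

lemma defExpCoeff_succ (θ : ℝ) (n : ℕ) :
    defExpCoeff θ (n + 1) = -(defExpCoeff θ n * θ ^ n / (n + 1)) := by
  have h : (n + 1) * (n + 1 - 1) / 2 = n * (n - 1) / 2 + n := by
    rw [← Finset.sum_range_id_mul_two, ← Finset.sum_range_id_mul_two, Finset.sum_range_succ]
    omega
  have h1 : (n : ℝ) + 1 ≠ 0 := by positivity
  have h2 : (n.factorial : ℝ) ≠ 0 := by positivity
  rw [defExpCoeff, defExpCoeff, h, Nat.factorial_succ]
  push_cast
  field_simp
  ring

lemma abs_defExpCoeff_le {θ : ℝ} (hθ : |θ| ≤ 1) (n : ℕ) :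
    |defExpCoeff θ n| ≤ 1 / n.factorial := by
  rw [defExpCoeff, abs_div, abs_mul, abs_pow, abs_pow, abs_neg, abs_one, one_pow, one_mul,
    Nat.abs_cast]
  gcongr
  exact pow_le_one₀ (abs_nonneg _) hθ

lemma sum_chainIntegral_mul_defExpCoeff (θ : ℝ) (n : ℕ) (b : ℝ) :
    ∑ k ∈ Finset.range (n + 1), chainIntegral θ k b * defExpCoeff θ (n - k) =
      defExpCoeff θ n * b ^ n := by
  induction n generalizing b with
  | zero => simp [chainIntegral]
  | succ n ih =>
    have hc (k : ℕ) : Continuous fun y => chainIntegral θ k (θ * y) :=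
      (continuous_chainIntegral θ k).comp (by fun_prop)
    have h : ∑ k ∈ Finset.range (n + 1),
        chainIntegral θ (k + 1) b * defExpCoeff θ (n + 1 - (k + 1)) =
        ∫ y in b..1, defExpCoeff θ n * θ ^ n * y ^ n := by
      simp_rw [Nat.add_sub_add_right, chainIntegral, ← intervalIntegral.integral_mul_const]
      rw [← intervalIntegral.integral_finsetSum
        fun k _ => ((hc k).intervalIntegrable _ _).mul_const _]
      simp_rw [ih, mul_pow, mul_assoc]
    rw [Finset.sum_range_succ', h, intervalIntegral.integral_const_mul, integral_pow,
      Nat.sub_zero, chainIntegral, defExpCoeff_succ]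
    field_simp
    ring

lemma isClosed_chainSet (a θ : ℝ) (n : ℕ) (b : ℝ) : IsClosed (chainSet a θ n b) := by
  simp only [chainSet, ofPred_and, ofPred_forall]
  refine (isClosed_le (by fun_prop) (by fun_prop)).inter
    ((isClosed_iInter fun i => isClosed_Icc.preimage (continuous_apply i)).inter
      (isClosed_iInter fun i => isClosed_le (by fun_prop) (by fun_prop)))

lemma cons_mem_chainSet {a θ b : ℝ} (hb : -a ≤ b) (n : ℕ) (y : ℝ) (t : Fin (n + 1) → ℝ) :
    (Fin.cons y t : Fin (n + 2) → ℝ) ∈ chainSet a θ (n + 1) b ↔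
      y ∈ Icc b 1 ∧ t ∈ chainSet a θ n (θ * y) := by
  simp only [chainSet, mem_ofPred_eq, Fin.forall_fin_succ (n := n + 1), Fin.cons_zero,
    Fin.cons_succ, mem_Icc]
  rw [Fin.forall_fin_succ (P := fun i : Fin (n + 1) =>
    θ * (Fin.cons y t : Fin (n + 2) → ℝ) i.castSucc ≤ t i)]
  simp only [Fin.castSucc_zero, Fin.cons_zero, ← Fin.succ_castSucc, Fin.cons_succ]
  constructor
  · rintro ⟨h1, ⟨⟨h2, h3⟩, h4⟩, h5, h6⟩
    exact ⟨⟨h1, h3⟩, h5, h4, h6⟩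
  · rintro ⟨⟨h1, h3⟩, h5, h4, h6⟩
    exact ⟨h1, ⟨⟨hb.trans h1, h3⟩, h4⟩, h5, h6⟩

lemma volume_chainSet_zero {a θ b : ℝ} (hb : -a ≤ b) :
    volume (chainSet a θ 0 b) = ENNReal.ofReal (1 - b) := by
  have h : chainSet a θ 0 b = (MeasurableEquiv.funUnique (Fin 1) ℝ) ⁻¹' Icc b 1 := by
    ext x
    simp only [chainSet, mem_ofPred_eq, mem_preimage, mem_Icc, MeasurableEquiv.funUnique_apply,
      Fin.default_eq_zero, IsEmpty.forall_iff, and_true]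
    refine ⟨fun h => ⟨h.1, (h.2 0).2⟩, fun h => ⟨h.1, fun i => ?_⟩⟩
    rw [Fin.fin_one_eq_zero i]
    exact ⟨hb.trans h.1, h.2⟩
  rw [h]
  exact ((volume_preserving_funUnique (Fin 1) ℝ).measure_preimage_equiv _).trans Real.volume_Icc

lemma volume_chainSet_succ {a θ b : ℝ} (hb : -a ≤ b) (n : ℕ) :
    volume (chainSet a θ (n + 1) b) = ∫⁻ y in Icc b 1, volume (chainSet a θ n (θ * y)) := by
  have he := (volume_preserving_piFinSuccAbove (fun _ : Fin (n + 2) => ℝ) 0).symm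
  have hm := (isClosed_chainSet a θ (n + 1) b).measurableSet
  rw [← he.measure_preimage hm.nullMeasurableSet, Measure.volume_eq_prod,
    Measure.prod_apply ((MeasurableEquiv.measurable _) hm), ← lintegral_indicator measurableSet_Icc]
  congr 1 with y
  have hs : Prod.mk y ⁻¹' ((MeasurableEquiv.piFinSuccAbove (fun _ : Fin (n + 2) => ℝ) 0).symm ⁻¹'
      chainSet a θ (n + 1) b) = {t | y ∈ Icc b 1 ∧ t ∈ chainSet a θ n (θ * y)} := by
    ext t
    rw [mem_ofPred_eq, ← cons_mem_chainSet hb, mem_preimage, mem_preimage,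
      MeasurableEquiv.piFinSuccAbove_symm_apply]
    simp [Fin.insertNthEquiv]
  rw [hs]
  by_cases hy : y ∈ Icc b 1 <;> simp [hy]

lemma mul_mem_Icc_inv_one {θ x : ℝ} (hθ : θ ∈ Ico (-1 : ℝ) 0) (hx : x ∈ Icc (1 / θ) 1) :
    θ * x ∈ Icc (1 / θ) 1 := by
  obtain ⟨h1, h2⟩ := hθ
  have h3 : 1 / θ ≤ -1 := by rw [div_le_iff_of_neg h2]; linarith
  have h4 : θ * (1 / θ) = 1 := mul_one_div_cancel h2.ne
  constructor <;> nlinarith [hx.1, hx.2]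

lemma chainIntegral_nonneg {θ : ℝ} (hθ : θ ∈ Ico (-1 : ℝ) 0) (n : ℕ) {b : ℝ}
    (hb : b ∈ Icc (1 / θ) 1) : 0 ≤ chainIntegral θ n b := by
  induction n generalizing b with
  | zero => exact zero_le_one
  | succ n ih =>
    exact intervalIntegral.integral_nonneg hb.2 fun y hy =>
      ih (mul_mem_Icc_inv_one hθ ⟨hb.1.trans hy.1, hy.2⟩)

lemma volume_chainSet {a θ : ℝ} (hθ : θ ∈ Ico (-1 : ℝ) 0) (ha : -1 / θ ≤ a) (n : ℕ) {b : ℝ}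
    (hb : b ∈ Icc (1 / θ) 1) :
    volume (chainSet a θ n b) = ENNReal.ofReal (chainIntegral θ (n + 1) b) := by
  have hab : -a ≤ b := by
    have := hb.1
    rw [neg_div] at ha
    linarith
  induction n generalizing b with
  | zero => simp [volume_chainSet_zero hab, chainIntegral]
  | succ n ih =>
    have hmaps {y : ℝ} (hy : y ∈ Icc b 1) : θ * y ∈ Icc (1 / θ) 1 :=
      mul_mem_Icc_inv_one hθ ⟨hb.1.trans hy.1, hy.2⟩
    have hc : Continuous fun y => chainIntegral θ (n + 1) (θ * y) :=
      (continuous_chainIntegral θ (n + 1)).comp (by fun_prop)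
    rw [volume_chainSet_succ hab, chainIntegral, intervalIntegral.integral_of_le hb.2,
      ← integral_Icc_eq_integral_Ioc, ofReal_integral_eq_lintegral_ofReal
        hc.continuousOn.integrableOn_Icc
        ((ae_restrict_mem measurableSet_Icc).mono
          fun y hy => chainIntegral_nonneg hθ _ (hmaps hy))]
    refine setLIntegral_congr_fun measurableSet_Icc fun y hy => ih (hmaps hy) ?_
    have := (hmaps hy).1
    rw [neg_div] at ha
    linarith

lemma persprob_succ {a θ : ℝ} (hθ : θ ∈ Ico (-1 : ℝ) 0) (ha : -1 / θ ≤ a) (n : ℕ) :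
    persprob a θ (n + 1) = chainIntegral θ (n + 2) (1 / θ) / (1 + a) ^ (n + 2) := by
  have hb : 1 / θ ∈ Icc (1 / θ) 1 :=
    ⟨le_rfl, (one_div_neg.2 hθ.2).le.trans zero_le_one⟩
  have hset : {x : Fin (n + 2) → ℝ | (∀ i, x i ∈ Icc (-a) 1) ∧
      ∀ i : Fin (n + 1), θ * x i.castSucc ≤ x i.succ} = chainSet a θ (n + 1) (1 / θ) := by
    ext x
    refine ⟨fun h => ⟨?_, h⟩, fun h => h.2⟩
    rw [div_le_iff_of_neg hθ.2, mul_comm]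
    exact (h.2 0).trans (h.1 _).2
  rw [persprob, hset, volume_chainSet hθ ha _ hb,
    ENNReal.toReal_ofReal (chainIntegral_nonneg hθ _ hb)]

lemma abs_persprob_le_one {a : ℝ} (ha : -1 < a) (θ : ℝ) (n : ℕ) : |persprob a θ n| ≤ 1 := by
  cases n with
  | zero => simp [persprob]
  | succ n =>
    have ha' : 0 < 1 + a := by linarith
    rw [persprob, abs_of_nonneg (by positivity), div_le_one (by positivity)]
    have hbox : volume (Set.pi univ fun _ : Fin (n + 2) => Icc (-a) 1) =
        ENNReal.ofReal ((1 + a) ^ (n + 2)) := by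
      rw [volume_pi_pi]
      simp [Real.volume_Icc, ENNReal.ofReal_pow ha'.le]
    refine ENNReal.toReal_le_of_le_ofReal (by positivity) (hbox ▸ measure_mono fun x hx => ?_)
    exact fun i _ => hx.1 i

lemma defExp_term_neg (θ : ℝ) (w : ℂ) (n : ℕ) :
    (θ : ℂ) ^ (n * (n - 1) / 2) * (-w) ^ n / (n.factorial : ℂ) =
      (defExpCoeff θ n : ℂ) * w ^ n := by
  rw [defExpCoeff, neg_pow]
  push_cast
  ring

lemma norm_defExpCoeff_mul_pow_le {θ : ℝ} (hθ : |θ| ≤ 1) (w : ℂ) (n : ℕ) :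
    ‖(defExpCoeff θ n : ℂ) * w ^ n‖ ≤ ‖w‖ ^ n / n.factorial := by
  rw [norm_mul, norm_pow, Complex.norm_real, Real.norm_eq_abs, div_eq_inv_mul, ← one_div]
  gcongr
  exact abs_defExpCoeff_le hθ n

lemma summable_norm_defExpCoeff_mul_pow {θ : ℝ} (hθ : |θ| ≤ 1) (w : ℂ) :
    Summable fun n => ‖(defExpCoeff θ n : ℂ) * w ^ n‖ :=
  (Real.summable_pow_div_factorial ‖w‖).of_nonneg_of_le (fun _ => norm_nonneg _)
    (norm_defExpCoeff_mul_pow_le hθ w)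

lemma defExp_neg_eq_tsum (θ : ℝ) (w : ℂ) :
    defExp θ (-w) = ∑' n, (defExpCoeff θ n : ℂ) * w ^ n :=
  tsum_congr (defExp_term_neg θ w)

lemma defExp_neg_ne_zero {θ : ℝ} (hθ : |θ| ≤ 1) {w : ℂ} (hw : ‖w‖ < 1 / 2) :
    defExp θ (-w) ≠ 0 := by
  have hs := summable_norm_defExpCoeff_mul_pow hθ w
  have he := Real.summable_pow_div_factorial ‖w‖
  have hexp : Real.exp ‖w‖ = 1 + ∑' n : ℕ, ‖w‖ ^ (n + 1) / (n + 1).factorial := by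
    rw [Real.exp_eq_exp_ℝ, NormedSpace.exp_eq_tsum_div]
    simp only []
    rw [he.tsum_eq_zero_add]
    simp
  have htail : ‖∑' n : ℕ, (defExpCoeff θ (n + 1) : ℂ) * w ^ (n + 1)‖ ≤
      ∑' n : ℕ, ‖w‖ ^ (n + 1) / (n + 1).factorial :=
    tsum_of_norm_bounded ((summable_nat_add_iff 1).2 he).hasSum
      fun n => norm_defExpCoeff_mul_pow_le hθ w (n + 1)
  have hlt : Real.exp ‖w‖ < 2 := by
    have h := Real.exp_bound_div_one_sub_of_interval (norm_nonneg w) (by linarith)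
    refine h.trans_lt ?_
    rw [div_lt_iff₀ (by linarith)]
    linarith
  rw [defExp_neg_eq_tsum, hs.of_norm.tsum_eq_zero_add]
  intro h0
  rw [defExpCoeff_zero] at h0
  have h1 : ∑' n : ℕ, (defExpCoeff θ (n + 1) : ℂ) * w ^ (n + 1) = -1 := by
    simp only [Complex.ofReal_one, pow_zero, mul_one] at h0
    linear_combination h0
  rw [h1, norm_neg, norm_one] at htail
  linarith

/-- The generating function of the iterated integrals is a quotient of deformed exponentials. -/
lemma tsum_chainIntegral_mul_defExp {θ : ℝ} (hθ : |θ| ≤ 1) {b : ℝ} {w : ℂ}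
    (hs : Summable fun n => ‖(chainIntegral θ n b : ℂ) * w ^ n‖) :
    (∑' n, (chainIntegral θ n b : ℂ) * w ^ n) * defExp θ (-w) = defExp θ (-(b * w)) := by
  rw [defExp_neg_eq_tsum, defExp_neg_eq_tsum,
    tsum_mul_tsum_eq_tsum_sum_range_of_summable_norm hs (summable_norm_defExpCoeff_mul_pow hθ w)]
  refine tsum_congr fun n => ?_
  have h := congrArg (fun x : ℝ => (x : ℂ)) (sum_chainIntegral_mul_defExpCoeff θ n b)
  simp only [Complex.ofReal_sum, Complex.ofReal_mul, Complex.ofReal_pow] at h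
  rw [mul_pow, ← mul_assoc, ← h, Finset.sum_mul]
  refine Finset.sum_congr rfl fun k hk => ?_
  have hk' : k + (n - k) = n := by
    have := Finset.mem_range.1 hk
    omega
  conv_rhs => rw [← hk', pow_add]
  rw [add_tsub_cancel_left]
  ring

theorem green_region_generating_function (a θ : ℝ)
    (hθ : θ ∈ Ico (-1 : ℝ) 0) (ha : -1 / θ ≤ a) :
    ∃ ε > 0, ∀ z : ℂ, 0 < ‖z‖ → ‖z‖ < ε →
      ∑' n : ℕ, (persprob a θ n : ℂ) * z ^ n =
        (((θ * a + 1) / (θ * (1 + a)) : ℝ) : ℂ) +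
          (defExp θ (-z / (θ * (1 + a))) - defExp θ (-z / (1 + a))) /
            (z * defExp θ (-z / (1 + a))) := by
  have hθ0 : θ ≠ 0 := hθ.2.ne
  have ha0 : 0 < a := (div_pos_of_neg_of_neg (by norm_num) hθ.2).trans_le ha
  have ha1 : 1 + a ≠ 0 := by positivity
  have hθ1 : |θ| ≤ 1 := abs_le.2 ⟨hθ.1, hθ.2.le.trans zero_le_one⟩
  refine ⟨1 / 2, by norm_num, fun z hz0 hz => ?_⟩
  have hz' : z ≠ 0 := norm_pos_iff.1 hz0
  have hθC : (θ : ℂ) ≠ 0 := by exact_mod_cast hθ0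
  have haC : (1 + a : ℂ) ≠ 0 := by exact_mod_cast ha1
  set w : ℂ := z / (1 + a) with hw
  have hwn : ‖w‖ < 1 / 2 := by
    have h1 : ‖(1 + a : ℂ)‖ = 1 + a := by
      rw [← Complex.ofReal_one, ← Complex.ofReal_add, Complex.norm_real, Real.norm_eq_abs,
        abs_of_pos (by positivity)]
    rw [hw, norm_div, h1]
    exact (div_le_self (norm_nonneg z) (by linarith)).trans_lt hz
  have hterm (n : ℕ) : (chainIntegral θ (n + 2) (1 / θ) : ℂ) * w ^ (n + 2) =
      z * ((persprob a θ (n + 1) : ℂ) * z ^ (n + 1)) := by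
    rw [persprob_succ hθ ha, hw, div_pow]
    push_cast
    field_simp
    ring
  have hP : Summable fun n => ‖(persprob a θ n : ℂ) * z ^ n‖ := by
    refine (summable_geometric_of_lt_one (norm_nonneg z) (by linarith)).of_nonneg_of_le
      (fun _ => norm_nonneg _) fun n => ?_
    rw [norm_mul, norm_pow, Complex.norm_real]
    exact mul_le_of_le_one_left (by positivity) (abs_persprob_le_one (by linarith) θ n)
  have hQ : Summable fun n => ‖(chainIntegral θ n (1 / θ) : ℂ) * w ^ n‖ := by
    refine (summable_nat_add_iff 2).1 ?_
    simp only [hterm, norm_mul z]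
    exact ((summable_nat_add_iff 1).2 hP).mul_left _
  have hmain := tsum_chainIntegral_mul_defExp hθ1 hQ
  have hE := defExp_neg_ne_zero hθ1 hwn
  have h0 : chainIntegral θ 0 (1 / θ) = 1 := rfl
  have h1 : chainIntegral θ 1 (1 / θ) = 1 - 1 / θ := by simp [chainIntegral]
  rw [hQ.of_norm.tsum_eq_zero_add,
    ((summable_nat_add_iff 1).2 hQ.of_norm).tsum_eq_zero_add] at hmain
  simp only [add_assoc, Nat.reduceAdd, hterm, tsum_mul_left, zero_add, h0, h1] at hmain
  rw [hP.of_norm.tsum_eq_zero_add]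
  have e1 : -z / (1 + a) = -w := by rw [hw]; ring
  have e2 : -z / (θ * (1 + a)) = -(((1 / θ : ℝ) : ℂ) * w) := by
    rw [hw]; push_cast; field_simp
  rw [e1, e2, ← hmain]
  have hp0 : persprob a θ 0 = 1 := rfl
  rw [hp0]
  generalize ∑' n : ℕ, (persprob a θ (n + 1) : ℂ) * z ^ (n + 1) = S
  rw [hw]
  rw [hw] at hE
  push_cast
  field_simp
  ring
end

section
/- Let θ ∈ [-1,0) and a ∈ [0,-θ], and set μ := (1 + a/θ)/(1+a). Then there exists ε > 0 such that for all complex z with |z| < ε one has z · (∑_{n=0}^∞ p_n^a(θ) z^n) · (E(θ, az/(θ(1+a))) − μ·z·E(θ, az/(1+a))) = E(θ, az/(1+a)) − E(θ, az/(θ(1+a))) + μ·z·E(θ, az/(1+a)); i.e., the generating function of the persistence probabilities equals (1/z)·(1/[E(θ, az/(θ(1+a)))/E(θ, az/(1+a)) − μz] − 1). -/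
open MeasureTheory Set

/-- The `k`-th term of the deformed exponential series. -/
noncomputable def defExpTerm (r : ℝ) (k : ℕ) (t : ℝ) : ℝ :=
  r ^ (k * (k - 1) / 2) * t ^ k / (k.factorial : ℝ)

/-- Volume of the set of length-`n` continuations in `[-a,1]` of a path currently at `x`. -/
noncomputable def contVol (a θ : ℝ) : ℕ → ℝ → ℝ
  | 0 => fun _ => 1
  | n + 1 => fun x => ∫ y in (max (-a) (θ * x))..1, contVol a θ n y

/-- The set of length-`n` continuations in `[-a,1]` of a path currently at `x`. -/
def contSet (a θ : ℝ) (n : ℕ) (x : ℝ) : Set (Fin n → ℝ) :=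
  {v | (∀ i, v i ∈ Icc (-a) 1) ∧
    ∀ i : Fin n, θ * (Fin.cons x v : Fin (n + 1) → ℝ) i.castSucc ≤ v i}

theorem continuous_contVol (a θ : ℝ) (n : ℕ) : Continuous (contVol a θ n) := by
  induction n with
  | zero => exact continuous_const
  | succ n ih =>
    have h : Continuous fun b => ∫ y in (1 : ℝ)..b, contVol a θ n y :=
      intervalIntegral.continuous_primitive (fun _ _ => ih.intervalIntegrable _ _) 1
    have h' : contVol a θ (n + 1) =
        fun x => -∫ y in (1 : ℝ)..(max (-a) (θ * x)), contVol a θ n y := by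
      funext x
      rw [← intervalIntegral.integral_symm]
      rfl
    rw [h']
    exact (h.comp (by fun_prop : Continuous fun x => max (-a) (θ * x))).neg

section

variable {a θ : ℝ}

theorem lower_limit_le_one (hθ : θ ∈ Ico (-1 : ℝ) 0) (ha : a ∈ Icc (0 : ℝ) (-θ)) {x : ℝ}
    (hx : -a ≤ x) : max (-a) (θ * x) ≤ 1 := by
  obtain ⟨h1, h2⟩ := hθ
  obtain ⟨h3, h4⟩ := ha
  refine max_le (by linarith) ?_
  nlinarith [mul_le_mul_of_nonpos_left hx h2.le]

theorem contVol_mem_Icc (hθ : θ ∈ Ico (-1 : ℝ) 0) (ha : a ∈ Icc (0 : ℝ) (-θ)) (n : ℕ) :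
    ∀ x, -a ≤ x → contVol a θ n x ∈ Icc 0 ((1 + a) ^ n) := by
  have ha0 := ha.1
  induction n with
  | zero => intro x _; simp [contVol]
  | succ n ih =>
    intro x hx
    have hl := lower_limit_le_one hθ ha hx
    have hl' : -a ≤ max (-a) (θ * x) := le_max_left _ _
    constructor
    · exact intervalIntegral.integral_nonneg hl fun y hy => (ih y (hl'.trans hy.1)).1
    · calc contVol a θ (n + 1) x
          ≤ ∫ _y in (max (-a) (θ * x))..1, (1 + a) ^ n :=
            intervalIntegral.integral_mono_on hl
              ((continuous_contVol a θ n).intervalIntegrable _ _)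
              (continuous_const.intervalIntegrable _ _)
              fun y hy => (ih y (hl'.trans hy.1)).2
        _ = (1 - max (-a) (θ * x)) * (1 + a) ^ n := by simp
        _ ≤ (1 + a) * (1 + a) ^ n := by gcongr; linarith
        _ = (1 + a) ^ (n + 1) := by ring

theorem isClosed_contSet (n : ℕ) (x : ℝ) : IsClosed (contSet a θ n x) := by
  have hc : ∀ j : Fin (n + 1),
      Continuous fun v : Fin n → ℝ => (Fin.cons x v : Fin (n + 1) → ℝ) j := by
    intro j
    refine Fin.cases ?_ (fun i => ?_) j
    · simpa using continuous_const
    · simpa using continuous_apply i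
  simp only [contSet, ofPred_and, ofPred_forall]
  refine IsClosed.inter (isClosed_iInter fun i => ?_) (isClosed_iInter fun i => ?_)
  · exact isClosed_Icc.preimage (continuous_apply i)
  · exact isClosed_le (continuous_const.mul (hc _)) (continuous_apply i)

theorem cons_mem_contSet_succ {n : ℕ} {x y : ℝ} {v : Fin n → ℝ} :
    (Fin.cons y v : Fin (n + 1) → ℝ) ∈ contSet a θ (n + 1) x ↔
      y ∈ Icc (max (-a) (θ * x)) 1 ∧ v ∈ contSet a θ n y := by
  simp only [contSet, mem_ofPred_eq, Fin.forall_fin_succ, mem_Icc, max_le_iff]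
  simp
  tauto

theorem volume_contSet (hθ : θ ∈ Ico (-1 : ℝ) 0) (ha : a ∈ Icc (0 : ℝ) (-θ)) (n : ℕ) :
    ∀ x, -a ≤ x → volume (contSet a θ n x) = ENNReal.ofReal (contVol a θ n x) := by
  induction n with
  | zero =>
    intro x _
    have : contSet a θ 0 x = univ := by ext v; simp [contSet]
    simp [this, contVol, volume_pi]
  | succ n ih =>
    intro x hx
    have hl := lower_limit_le_one hθ ha hx
    have hl' : -a ≤ max (-a) (θ * x) := le_max_left _ _
    have hmp := (volume_preserving_piFinSuccAbove (fun _ : Fin (n + 1) => ℝ) 0).symm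
    have hm := (isClosed_contSet (a := a) (θ := θ) (n + 1) x).measurableSet
    rw [← hmp.measure_preimage hm.nullMeasurableSet, Measure.volume_eq_prod,
      Measure.prod_apply (hmp.measurable hm)]
    have hs : ∀ y : ℝ, volume (Prod.mk y ⁻¹'
        ((MeasurableEquiv.piFinSuccAbove (fun _ : Fin (n + 1) => ℝ) 0).symm ⁻¹'
          contSet a θ (n + 1) x)) =
        (Icc (max (-a) (θ * x)) 1).indicator
          (fun y => ENNReal.ofReal (contVol a θ n y)) y := by
      intro y
      have : Prod.mk y ⁻¹'
        ((MeasurableEquiv.piFinSuccAbove (fun _ : Fin (n + 1) => ℝ) 0).symm ⁻¹'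
          contSet a θ (n + 1) x) =
          {v | y ∈ Icc (max (-a) (θ * x)) 1 ∧ v ∈ contSet a θ n y} := by
        ext v
        rw [mem_ofPred_eq, ← cons_mem_contSet_succ]
        simp [MeasurableEquiv.piFinSuccAbove, Fin.consEquiv]
      rw [this]
      by_cases hy : y ∈ Icc (max (-a) (θ * x)) 1
      · simp only [hy, true_and, indicator_of_mem, ofPred_mem_eq]
        exact ih y (hl'.trans hy.1)
      · simp [hy]
    have hint : IntegrableOn (contVol a θ n) (Icc (max (-a) (θ * x)) 1) :=
      (continuous_contVol a θ n).integrableOn_Icc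
    simp_rw [hs]
    rw [lintegral_indicator measurableSet_Icc, ← ofReal_integral_eq_lintegral_ofReal hint
      ((ae_restrict_iff' measurableSet_Icc).2 (.of_forall fun y hy =>
        (contVol_mem_Icc hθ ha n y (hl'.trans hy.1)).1)), integral_Icc_eq_integral_Ioc,
      ← intervalIntegral.integral_of_le hl]
    rfl

theorem persprob_eq (hθ : θ ∈ Ico (-1 : ℝ) 0) (ha : a ∈ Icc (0 : ℝ) (-θ)) (n : ℕ) :
    persprob a θ n = contVol a θ (n + 1) 1 / (1 + a) ^ (n + 1) := by
  obtain ⟨h3, h4⟩ := ha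
  cases n with
  | zero =>
    have : (1 + a) ≠ 0 := by linarith
    simp [persprob, contVol, max_eq_left (show θ ≤ -a by linarith), this]
  | succ n =>
    have hset : {x : Fin (n + 2) → ℝ | (∀ i, x i ∈ Icc (-a) 1) ∧
        ∀ i : Fin (n + 1), θ * x i.castSucc ≤ x i.succ} = contSet a θ (n + 2) 1 := by
      ext v
      simp only [contSet, mem_ofPred_eq]
      refine and_congr_right fun hv => ?_
      conv_rhs => rw [Fin.forall_fin_succ]
      simp only [← Fin.succ_castSucc, Fin.cons_succ, Fin.castSucc_zero, Fin.cons_zero]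
      have := (hv 0).1
      exact (and_iff_right (by linarith)).symm
    rw [persprob, hset, volume_contSet hθ ⟨h3, h4⟩ _ _ (by linarith),
      ENNReal.toReal_ofReal (contVol_mem_Icc hθ ⟨h3, h4⟩ _ _ (by linarith)).1]

theorem hasDerivAt_defExpTerm_succ (r : ℝ) (k : ℕ) (x : ℝ) :
    HasDerivAt (fun x => -defExpTerm r (k + 1) (-x)) (defExpTerm r k (-(r * x))) x := by
  have hexp : (k + 1) * (k + 1 - 1) / 2 = k * (k - 1) / 2 + k := by
    rw [← Finset.sum_range_id_mul_two, ← Finset.sum_range_id_mul_two,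
      Nat.mul_div_cancel _ two_pos, Nat.mul_div_cancel _ two_pos, Finset.sum_range_succ]
  have h := ((((hasDerivAt_id x).neg.pow (k + 1)).const_mul
    (r ^ ((k + 1) * (k + 1 - 1) / 2))).div_const ((k + 1).factorial : ℝ)).neg
  refine h.congr_deriv ?_
  have h1 : (k.factorial : ℝ) ≠ 0 := by positivity
  have h2 : (k : ℝ) + 1 ≠ 0 := by positivity
  rw [hexp, defExpTerm, Nat.factorial_succ]
  push_cast
  simp only [Pi.neg_apply, id]
  field_simp
  rw [pow_add, show -(x * r) = r * -x by ring, mul_pow]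
  ring

theorem defExpTerm_zero (r t : ℝ) : defExpTerm r 0 t = 1 := by simp [defExpTerm]

theorem defExpTerm_succ_zero (r : ℝ) (k : ℕ) : defExpTerm r (k + 1) 0 = 0 := by
  simp [defExpTerm]

theorem integral_sum_defExpTerm (r : ℝ) (c : ℕ → ℝ) (n : ℕ) (p q : ℝ) :
    ∫ y in p..q, ∑ k ∈ Finset.range (n + 1), c (n - k) * defExpTerm r k (-(r * y)) =
      ∑ k ∈ Finset.range (n + 1), c (n - k) * defExpTerm r (k + 1) (-p) -
        ∑ k ∈ Finset.range (n + 1), c (n - k) * defExpTerm r (k + 1) (-q) := by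
  have hd : ∀ y, HasDerivAt
      (fun y => ∑ k ∈ Finset.range (n + 1), c (n - k) * -defExpTerm r (k + 1) (-y))
      (∑ k ∈ Finset.range (n + 1), c (n - k) * defExpTerm r k (-(r * y))) y := fun y =>
    HasDerivAt.fun_sum fun k _ => (hasDerivAt_defExpTerm_succ r k y).const_mul _
  rw [intervalIntegral.integral_eq_sub_of_hasDerivAt (fun y _ => hd y)]
  · simp only [mul_neg, Finset.sum_neg_distrib]
    ring
  · apply Continuous.intervalIntegrable
    unfold defExpTerm
    fun_prop

theorem contVol_eq_sum (hθ : θ ∈ Ico (-1 : ℝ) 0) (ha : a ∈ Icc (0 : ℝ) (-θ)) (n : ℕ) :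
    ∀ x ∈ Icc (-a) (-a / θ), contVol a θ n x =
      ∑ k ∈ Finset.range (n + 1), contVol a θ (n - k) 0 * defExpTerm θ k (-(θ * x)) := by
  obtain ⟨h1, h2⟩ := hθ
  obtain ⟨h3, h4⟩ := ha
  have hI : 0 ≤ -a / θ := div_nonneg_of_nonpos (by linarith) h2.le
  have haI : a ≤ -a / θ := by rw [le_div_iff_of_neg h2]; nlinarith
  induction n with
  | zero => intro x _; simp [contVol, defExpTerm]
  | succ n ih =>
    intro x hx
    have hlo : -a ≤ θ * x := by
      have := mul_le_mul_of_nonpos_left hx.2 h2.le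
      rwa [mul_div_cancel₀ _ h2.ne] at this
    have hhi : θ * x ≤ a := by nlinarith [mul_le_mul_of_nonpos_left hx.1 h2.le]
    have hsplit : contVol a θ (n + 1) x =
        (∫ y in (θ * x)..0, contVol a θ n y) + contVol a θ (n + 1) 0 := by
      simp only [contVol, mul_zero, max_eq_right hlo, max_eq_right (neg_nonpos.2 h3)]
      rw [intervalIntegral.integral_add_adjacent_intervals] <;>
        exact (continuous_contVol a θ n).intervalIntegrable _ _
    have hcongr : ∫ y in (θ * x)..0, contVol a θ n y = ∫ y in (θ * x)..0,
        ∑ k ∈ Finset.range (n + 1), contVol a θ (n - k) 0 * defExpTerm θ k (-(θ * y)) := by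
      refine intervalIntegral.integral_congr fun y hy => ih y ?_
      exact uIcc_subset_Icc ⟨hlo, hhi.trans haI⟩ ⟨by linarith, hI⟩ hy
    rw [hsplit, hcongr, integral_sum_defExpTerm θ (fun m => contVol a θ m 0),
      Finset.sum_range_succ' _ (n + 1)]
    simp [defExpTerm_zero, defExpTerm_succ_zero]

theorem contVol_eq_contVol_one (hθ : θ ∈ Ico (-1 : ℝ) 0) (ha : a ∈ Icc (0 : ℝ) (-θ)) (n : ℕ)
    {x : ℝ} (hx : -a / θ ≤ x) : contVol a θ n x = contVol a θ n 1 := by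
  cases n with
  | zero => rfl
  | succ n =>
    have h : θ * x ≤ -a := by
      have := mul_le_mul_of_nonpos_left hx hθ.2.le
      rwa [mul_div_cancel₀ _ hθ.2.ne] at this
    have h' : θ ≤ -a := by linarith [ha.2]
    simp [contVol, h, h']

theorem contVol_one_eq_sum (hθ : θ ∈ Ico (-1 : ℝ) 0) (ha : a ∈ Icc (0 : ℝ) (-θ)) (n : ℕ) :
    contVol a θ n 1 =
      ∑ k ∈ Finset.range (n + 1), contVol a θ (n - k) 0 * defExpTerm θ k a := by
  have hI : 0 ≤ -a / θ := div_nonneg_of_nonpos (by linarith [ha.1]) hθ.2.le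
  rw [← contVol_eq_contVol_one hθ ha n le_rfl,
    contVol_eq_sum hθ ha n _ ⟨by linarith [ha.1], le_rfl⟩, mul_div_cancel₀ _ hθ.2.ne, neg_neg]

theorem sum_contVol_zero_mul_defExpTerm_div (hθ : θ ∈ Ico (-1 : ℝ) 0)
    (ha : a ∈ Icc (0 : ℝ) (-θ)) (n : ℕ) :
    ∑ k ∈ Finset.range (n + 2), contVol a θ (n + 1 - k) 0 * defExpTerm θ k (a / θ) =
      (1 + a / θ) * contVol a θ n 1 := by
  have hI : 0 ≤ -a / θ := div_nonneg_of_nonpos (by linarith [ha.1]) hθ.2.le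
  have hI1 : -a / θ ≤ 1 := by rw [div_le_iff_of_neg hθ.2]; linarith [ha.2]
  have hV : contVol a θ (n + 1) 1 = (∫ y in (-a)..(-a / θ), contVol a θ n y) +
      ∫ y in (-a / θ)..1, contVol a θ n y := by
    rw [intervalIntegral.integral_add_adjacent_intervals]
    · simp only [contVol]
      rw [max_eq_left (by linarith [ha.2])]
    all_goals exact (continuous_contVol a θ n).intervalIntegrable _ _
  have hleft : ∫ y in (-a)..(-a / θ), contVol a θ n y = ∫ y in (-a)..(-a / θ),
      ∑ k ∈ Finset.range (n + 1), contVol a θ (n - k) 0 * defExpTerm θ k (-(θ * y)) := by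
    refine intervalIntegral.integral_congr fun y hy => contVol_eq_sum hθ ha n y ?_
    rwa [uIcc_of_le (by linarith [ha.1])] at hy
  have hright : ∫ y in (-a / θ)..1, contVol a θ n y =
      ∫ _y in (-a / θ)..1, contVol a θ n 1 := by
    refine intervalIntegral.integral_congr fun y hy => contVol_eq_contVol_one hθ ha n ?_
    rw [uIcc_of_le hI1] at hy
    exact hy.1
  rw [hleft, hright, integral_sum_defExpTerm θ (fun m => contVol a θ m 0),
    intervalIntegral.integral_const, contVol_one_eq_sum hθ ha (n + 1),
    Finset.sum_range_succ' _ (n + 1)] at hV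
  rw [Finset.sum_range_succ' _ (n + 1)]
  simp only [defExpTerm_zero, Nat.add_sub_add_right, neg_neg, neg_div, smul_eq_mul,
    sub_neg_eq_add] at hV ⊢
  linarith

theorem norm_defExp_term_le {r : ℂ} (hr : ‖r‖ ≤ 1) (t : ℂ) (n : ℕ) :
    ‖r ^ (n * (n - 1) / 2) * t ^ n / (n.factorial : ℂ)‖ ≤ ‖t‖ ^ n / n.factorial := by
  rw [norm_div, norm_mul, norm_pow, norm_pow, Complex.norm_natCast]
  gcongr
  exact mul_le_of_le_one_left (by positivity) (pow_le_one₀ (norm_nonneg _) hr)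

theorem summable_norm_defExp {r : ℂ} (hr : ‖r‖ ≤ 1) (t : ℂ) :
    Summable fun n : ℕ => ‖r ^ (n * (n - 1) / 2) * t ^ n / (n.factorial : ℂ)‖ :=
  .of_nonneg_of_le (fun _ => norm_nonneg _) (norm_defExp_term_le hr t)
    (Real.summable_pow_div_factorial _)

theorem tsum_mul_defExp {r : ℝ} (hr : ‖(r : ℂ)‖ ≤ 1) (c : ℕ → ℝ) (t : ℝ) (w : ℂ)
    (hc : Summable fun n => ‖(c n : ℂ) * w ^ n‖) :
    (∑' n, (c n : ℂ) * w ^ n) * defExp r (t * w) =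
      ∑' n, ((∑ k ∈ Finset.range (n + 1), c (n - k) * defExpTerm r k t : ℝ) : ℂ) * w ^ n := by
  rw [mul_comm, defExp, tsum_mul_tsum_eq_tsum_sum_range_of_summable_norm
    (summable_norm_defExp hr _) hc]
  refine tsum_congr fun n => ?_
  push_cast
  rw [Finset.sum_mul]
  refine Finset.sum_congr rfl fun k hk => ?_
  have hkn : k + (n - k) = n := by
    have := Finset.mem_range.1 hk
    omega
  conv_rhs => rw [← hkn, Nat.add_sub_cancel_left]
  rw [defExpTerm]
  push_cast
  rw [mul_pow, pow_add]
  ring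

theorem summable_norm_contVol (hθ : θ ∈ Ico (-1 : ℝ) 0) (ha : a ∈ Icc (0 : ℝ) (-θ)) {x : ℝ}
    (hx : -a ≤ x) {z : ℂ} (hz : ‖z‖ < 1) :
    Summable fun n => ‖(contVol a θ n x : ℂ) * (z / (1 + a)) ^ n‖ := by
  have hpos : 0 < 1 + a := by linarith [ha.1]
  refine .of_nonneg_of_le (fun _ => norm_nonneg _) (fun n => ?_)
    (summable_geometric_of_lt_one (norm_nonneg z) hz)
  obtain ⟨hn0, hn1⟩ := contVol_mem_Icc hθ ha n x hx
  have h1a : ‖(1 + a : ℂ)‖ = 1 + a := by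
    rw [← Complex.ofReal_one, ← Complex.ofReal_add, Complex.norm_real, Real.norm_of_nonneg hpos.le]
  rw [norm_mul, Complex.norm_real, Real.norm_of_nonneg hn0, norm_pow, norm_div, h1a, div_pow]
  calc _ ≤ (1 + a) ^ n * (‖z‖ ^ n / (1 + a) ^ n) := by gcongr
    _ = ‖z‖ ^ n := by field_simp

end

theorem yellow_region_generating_function (a θ : ℝ)
    (hθ : θ ∈ Ico (-1 : ℝ) 0) (ha : a ∈ Icc (0 : ℝ) (-θ))
    (μ : ℝ) (hμ : μ = (1 + a / θ) / (1 + a)) :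
    ∃ ε > 0, ∀ z : ℂ, ‖z‖ < ε →
      z * (∑' n : ℕ, (persprob a θ n : ℂ) * z ^ n) *
          (defExp θ ((a : ℂ) * z / (θ * (1 + a))) -
            (μ : ℂ) * z * defExp θ ((a : ℂ) * z / (1 + a))) =
        defExp θ ((a : ℂ) * z / (1 + a)) - defExp θ ((a : ℂ) * z / (θ * (1 + a))) +
          (μ : ℂ) * z * defExp θ ((a : ℂ) * z / (1 + a)) := by
  refine ⟨1, one_pos, fun z hz => ?_⟩
  have ha0 := ha.1
  have hr : ‖(θ : ℂ)‖ ≤ 1 := by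
    rw [Complex.norm_real, Real.norm_eq_abs, abs_le]
    constructor <;> linarith [hθ.1, hθ.2]
  set w : ℂ := z / (1 + a) with hw
  have hC := summable_norm_contVol hθ ha (x := 0) (by linarith) hz
  have hU := (summable_norm_contVol hθ ha (x := 1) (by linarith) hz).of_norm
  rw [← hw] at hC hU
  have e1 : (a : ℂ) * z / (1 + a) = (a : ℝ) * w := by rw [hw]; ring
  have e2 : (a : ℂ) * z / (θ * (1 + a)) = ((a / θ : ℝ) : ℂ) * w := by
    rw [hw]; push_cast; rw [div_mul_div_comm]
  have e3 : (μ : ℂ) * z = ((1 + a / θ : ℝ) : ℂ) * w := by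
    rw [hμ, hw]; push_cast; ring
  have hUC := tsum_mul_defExp hr (fun n => contVol a θ n 0) a w hC
  have hDC := tsum_mul_defExp hr (fun n => contVol a θ n 0) (a / θ) w hC
  simp only [← contVol_one_eq_sum hθ ha] at hUC
  have hP : z * (∑' n : ℕ, (persprob a θ n : ℂ) * z ^ n) =
      (∑' n, (contVol a θ n 1 : ℂ) * w ^ n) - 1 := by
    rw [hU.tsum_eq_zero_add, ← tsum_mul_left]
    have : ∀ n : ℕ, z * ((persprob a θ n : ℂ) * z ^ n) =
        (contVol a θ (n + 1) 1 : ℂ) * w ^ (n + 1) := by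
      intro n
      rw [persprob_eq hθ ha, hw, div_pow]
      push_cast
      ring
    simp [this, contVol]
  have hD : (∑' n, ((∑ k ∈ Finset.range (n + 1),
      contVol a θ (n - k) 0 * defExpTerm θ k (a / θ) : ℝ) : ℂ) * w ^ n) =
      1 + ((1 + a / θ : ℝ) : ℂ) * w * ∑' n, (contVol a θ n 1 : ℂ) * w ^ n := by
    have hs : ∀ n : ℕ, ((∑ k ∈ Finset.range (n + 1 + 1),
        contVol a θ (n + 1 - k) 0 * defExpTerm θ k (a / θ) : ℝ) : ℂ) * w ^ (n + 1) =
        ((1 + a / θ : ℝ) : ℂ) * w * ((contVol a θ n 1 : ℂ) * w ^ n) := by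
      intro n
      rw [sum_contVol_zero_mul_defExpTerm_div hθ ha n]
      push_cast
      ring
    rw [tsum_eq_zero_add', tsum_congr hs, tsum_mul_left]
    · simp [contVol, defExpTerm_zero]
    · exact (hU.mul_left _).congr fun n => (hs n).symm
  rw [hD] at hDC
  rw [hP, e1, e2, e3]
  linear_combination defExp θ ((a : ℝ) * w) * hDC - defExp θ (((a / θ : ℝ) : ℂ) * w) * hUC
end

section
/- Let either θ ∈ [0,1] and a ≥ 0, or θ ∈ [-1,0) and -θ ≤ a ≤ -1/θ. Then for every n ≥ 1 the persistence probabilities satisfy the recursion p_n^a(θ) = ∑_{k=1}^{n} ((-1)^{k-1}/k!) · θ^{k(k-1)/2} · (1+a)^{-k} · p_{n-k}^a(θ) + (1+a)^{-(n+1)} · (-1)^n · θ^{n(n+1)/2} · (1 − (−a)^{n+1})/(n+1)!. -/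
open MeasureTheory Set

/-- Iterated integrals `∫_{θt}^1 ∫_{θx₁}^1 ⋯ ∫_{θxₙ₋₁}^1 dxₙ ⋯ dx₁`. -/
noncomputable def iterInt (θ : ℝ) : ℕ → ℝ → ℝ
  | 0, _ => 1
  | n + 1, t => ∫ y in (θ * t)..1, iterInt θ n y

/-- The coefficients of the deformed exponential series in which `iterInt` expands. -/
noncomputable def qExpCoeff (θ : ℝ) (k : ℕ) : ℝ :=
  (-1) ^ k * θ ^ (k * (k + 1) / 2) / k.factorial

/-- Points of `[-a,1]^n` which, preceded by `t`, satisfy the persistence constraints. -/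
def tailSet (a θ : ℝ) (n : ℕ) (t : ℝ) : Set (Fin n → ℝ) :=
  {x | (∀ i, x i ∈ Icc (-a) 1) ∧
    ∀ i : Fin n, θ * (Fin.cons t x : Fin (n + 1) → ℝ) i.castSucc ≤ x i}

theorem qExpCoeff_succ (θ : ℝ) (k : ℕ) :
    qExpCoeff θ (k + 1) = -(qExpCoeff θ k * θ ^ (k + 1) / (k + 1)) := by
  have h : (k + 1) * (k + 1 + 1) / 2 = k * (k + 1) / 2 + (k + 1) := by
    rw [show (k + 1) * (k + 1 + 1) = k * (k + 1) + 2 * (k + 1) by ring]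
    exact Nat.add_mul_div_left _ _ two_pos
  have hk : (k : ℝ) + 1 ≠ 0 := by positivity
  have hf : (k.factorial : ℝ) ≠ 0 := by positivity
  rw [qExpCoeff, qExpCoeff, h, Nat.factorial_succ, pow_add θ, pow_succ (-1 : ℝ)]
  push_cast
  field_simp

theorem integral_sum_mul_pow (n : ℕ) (c : ℕ × ℕ → ℝ) (u v : ℝ) :
    ∫ y in u..v, ∑ p ∈ Finset.HasAntidiagonal.antidiagonal n, c p * y ^ p.2 =
      ∑ p ∈ Finset.HasAntidiagonal.antidiagonal n, c p * ((v ^ (p.2 + 1) - u ^ (p.2 + 1)) / (p.2 + 1)) := by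
  rw [intervalIntegral.integral_finsetSum]
  · simp [intervalIntegral.integral_const_mul, integral_pow]
  · intro p _
    exact Continuous.intervalIntegrable (by fun_prop) _ _

theorem iterInt_eq_sum (θ : ℝ) (n : ℕ) (t : ℝ) :
    iterInt θ n t =
      ∑ p ∈ Finset.HasAntidiagonal.antidiagonal n, iterInt θ p.1 0 * qExpCoeff θ p.2 * t ^ p.2 := by
  induction n generalizing t with
  | zero => simp [iterInt, qExpCoeff]
  | succ n ih =>
    rw [Finset.Nat.sum_antidiagonal_succ']
    have h0 : qExpCoeff θ 0 = 1 := by simp [qExpCoeff]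
    have hint : ∀ s, iterInt θ (n + 1) s = ∑ p ∈ Finset.HasAntidiagonal.antidiagonal n,
        iterInt θ p.1 0 * qExpCoeff θ p.2 *
          ((1 ^ (p.2 + 1) - (θ * s) ^ (p.2 + 1)) / (p.2 + 1)) := by
      intro s
      rw [iterInt]
      simp_rw [ih]
      rw [integral_sum_mul_pow]
    rw [hint t, hint 0, h0, mul_one, pow_zero, mul_one, ← Finset.sum_add_distrib]
    refine Finset.sum_congr rfl fun p _ => ?_
    rw [qExpCoeff_succ]
    ring

theorem continuous_iterInt (θ : ℝ) (n : ℕ) : Continuous (iterInt θ n) := by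
  rw [funext (iterInt_eq_sum θ n)]
  fun_prop

theorem integral_iterInt (θ : ℝ) (n : ℕ) (u v : ℝ) :
    ∫ y in u..v, iterInt θ n y = ∑ p ∈ Finset.HasAntidiagonal.antidiagonal n,
      iterInt θ p.1 0 * (qExpCoeff θ p.2 * ((v ^ (p.2 + 1) - u ^ (p.2 + 1)) / (p.2 + 1))) := by
  simp_rw [iterInt_eq_sum θ n, integral_sum_mul_pow, mul_assoc]

theorem integral_iterInt_succ (θ a : ℝ) (m : ℕ) :
    ∫ y in (-a)..1, iterInt θ (m + 1) y =
      (∑ p ∈ Finset.HasAntidiagonal.antidiagonal m,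
        qExpCoeff θ p.1 / (p.1 + 1) * ∫ y in (-a)..1, iterInt θ p.2 y) +
      qExpCoeff θ (m + 1) * ((1 - (-a) ^ (m + 2)) / (m + 2)) := by
  let C : PowerSeries ℝ := .mk fun n => iterInt θ n 0
  let E : PowerSeries ℝ := .mk fun n => qExpCoeff θ n / (n + 1)
  let D : PowerSeries ℝ := .mk fun n => qExpCoeff θ n * ((1 - (-a) ^ (n + 1)) / (n + 1))
  let V : PowerSeries ℝ := .mk fun n => ∫ y in (-a)..1, iterInt θ n y
  have hV : V = C * D := by
    ext n
    simp [V, C, D, PowerSeries.coeff_mul, integral_iterInt]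
  have hC : C = 1 + PowerSeries.X * (C * E) := by
    ext n
    cases n with
    | zero => simp [C, iterInt]
    | succ n =>
      rw [map_add, PowerSeries.coeff_succ_X_mul, PowerSeries.coeff_mul]
      simp only [C, E, PowerSeries.coeff_mk, PowerSeries.coeff_one]
      rw [iterInt, integral_iterInt]
      simp [div_eq_mul_inv]
  have hrec : V = PowerSeries.X * (E * V) + D := by
    rw [hV]
    linear_combination D * hC
  have := congrArg (PowerSeries.coeff (m + 1)) hrec
  rw [map_add, PowerSeries.coeff_succ_X_mul, PowerSeries.coeff_mul] at this
  simp only [V, E, D, PowerSeries.coeff_mk] at this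
  rw [this]
  push_cast
  ring

theorem isClosed_setOf_mem_tailSet (a θ : ℝ) (n : ℕ) :
    IsClosed {q : ℝ × (Fin n → ℝ) | q.2 ∈ tailSet a θ n q.1} := by
  have hc : ∀ j : Fin (n + 1),
      Continuous fun q : ℝ × (Fin n → ℝ) => (Fin.cons q.1 q.2 : Fin (n + 1) → ℝ) j := by
    intro j
    refine Fin.cases ?_ (fun i => ?_) j
    · simpa using continuous_fst
    · simp only [Fin.cons_succ]
      fun_prop
  simp only [tailSet, mem_ofPred_eq, mem_Icc]
  simp only [ofPred_and, ofPred_forall]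
  refine (isClosed_iInter fun i => ?_).inter (isClosed_iInter fun i => ?_)
  · exact (isClosed_le (by fun_prop) (by fun_prop)).inter
      (isClosed_le (by fun_prop) (by fun_prop))
  · exact isClosed_le (continuous_const.mul (hc _)) (by fun_prop)

theorem volume_setOf_tail_mem_tailSet (a θ : ℝ) (n : ℕ) {A : Set ℝ} (hA : MeasurableSet A) :
    volume {x : Fin (n + 1) → ℝ | x 0 ∈ A ∧ Fin.tail x ∈ tailSet a θ n (x 0)} =
      ∫⁻ y in A, volume (tailSet a θ n y) := by
  let B : Set (ℝ × (Fin n → ℝ)) := {q | q.1 ∈ A ∧ q.2 ∈ tailSet a θ n q.1}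
  have hB : MeasurableSet B :=
    (measurable_fst hA).inter (isClosed_setOf_mem_tailSet a θ n).measurableSet
  have hpre := (volume_preserving_piFinSuccAbove (fun _ : Fin (n + 1) => ℝ) 0).measure_preimage
    hB.nullMeasurableSet
  have hset : {x : Fin (n + 1) → ℝ | x 0 ∈ A ∧ Fin.tail x ∈ tailSet a θ n (x 0)} =
      MeasurableEquiv.piFinSuccAbove (fun _ : Fin (n + 1) => ℝ) 0 ⁻¹' B := by
    ext x
    rfl
  rw [hset, hpre, Measure.volume_eq_prod, Measure.prod_apply hB, ← lintegral_indicator hA]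
  refine lintegral_congr fun y => ?_
  by_cases hy : y ∈ A <;> simp [B, hy]

theorem tailSet_succ {a θ t : ℝ} (n : ℕ) (ht : -a ≤ θ * t) :
    tailSet a θ (n + 1) t =
      {x : Fin (n + 1) → ℝ | x 0 ∈ Icc (θ * t) 1 ∧ Fin.tail x ∈ tailSet a θ n (x 0)} := by
  ext x
  have hx : (Fin.cons (x 0) (Fin.tail x) : Fin (n + 1) → ℝ) = x := Fin.cons_self_tail x
  simp only [tailSet, mem_ofPred_eq, hx, Fin.forall_fin_succ (n := n), mem_Icc, Fin.tail,
    Fin.castSucc_zero, Fin.cons_zero, ← Fin.succ_castSucc, Fin.cons_succ]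
  constructor
  · rintro ⟨⟨h1, h2⟩, h3, h4⟩
    exact ⟨⟨h3, h1.2⟩, h2, h4⟩
  · rintro ⟨⟨h3, h1⟩, h2, h4⟩
    exact ⟨⟨⟨ht.trans h3, h1⟩, h2⟩, h3, h4⟩

theorem setLIntegral_volume_tailSet {a θ u : ℝ} (n : ℕ) (hu : u ≤ 1)
    (h : ∀ y ∈ Icc u 1, 0 ≤ iterInt θ n y ∧
      volume (tailSet a θ n y) = ENNReal.ofReal (iterInt θ n y)) :
    ∫⁻ y in Icc u 1, volume (tailSet a θ n y) =
      ENNReal.ofReal (∫ y in u..1, iterInt θ n y) := by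
  rw [setLIntegral_congr_fun measurableSet_Icc fun y hy => (h y hy).2,
    intervalIntegral.integral_of_le hu, ← integral_Icc_eq_integral_Ioc,
    ofReal_integral_eq_lintegral_ofReal]
  · exact (continuous_iterInt θ n).continuousOn.integrableOn_compact isCompact_Icc
  · exact (ae_restrict_iff' measurableSet_Icc).2 (ae_of_all _ fun y hy => (h y hy).1)

theorem volume_tailSet {a θ : ℝ}
    (hθ : ∀ t ∈ Icc (-a) 1, θ * t ∈ Icc (-a) 1) (n : ℕ) :
    ∀ t ∈ Icc (-a) 1, 0 ≤ iterInt θ n t ∧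
      volume (tailSet a θ n t) = ENNReal.ofReal (iterInt θ n t) := by
  induction n with
  | zero =>
    intro t _
    have : tailSet a θ 0 t = univ := by
      ext x
      simp [tailSet]
    simp [this, iterInt, volume_pi]
  | succ n ih =>
    intro t ht
    have h1 := hθ t ht
    have h2 : ∀ y ∈ Icc (θ * t) 1, y ∈ Icc (-a) 1 := fun y hy => ⟨h1.1.trans hy.1, hy.2⟩
    refine ⟨intervalIntegral.integral_nonneg h1.2 fun y hy => (ih y (h2 y hy)).1, ?_⟩
    rw [tailSet_succ n h1.1, volume_setOf_tail_mem_tailSet a θ n measurableSet_Icc,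
      setLIntegral_volume_tailSet n h1.2 fun y hy => ih y (h2 y hy), iterInt]

theorem persprob_eq_integral {a θ : ℝ} (ha : 0 ≤ a)
    (hθ : ∀ t ∈ Icc (-a) 1, θ * t ∈ Icc (-a) 1) (n : ℕ) :
    persprob a θ n = (∫ y in (-a)..1, iterInt θ n y) / (1 + a) ^ (n + 1) := by
  have ha' : 1 + a ≠ 0 := by positivity
  cases n with
  | zero => simp [persprob, iterInt, ha']
  | succ n =>
    have hset : {x : Fin (n + 2) → ℝ | (∀ i, x i ∈ Icc (-a) 1) ∧
        ∀ i : Fin (n + 1), θ * x i.castSucc ≤ x i.succ} =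
        {x : Fin (n + 2) → ℝ | x 0 ∈ Icc (-a) 1 ∧ Fin.tail x ∈ tailSet a θ (n + 1) (x 0)} := by
      ext x
      have hx : (Fin.cons (x 0) (Fin.tail x) : Fin (n + 2) → ℝ) = x := Fin.cons_self_tail x
      simp only [tailSet, mem_ofPred_eq, hx, Fin.forall_fin_succ (n := n + 1), Fin.tail, and_assoc]
    have hvol := volume_tailSet hθ (n + 1)
    have ha1 : -a ≤ 1 := by linarith
    rw [persprob, hset, volume_setOf_tail_mem_tailSet a θ (n + 1) measurableSet_Icc,
      setLIntegral_volume_tailSet (n + 1) ha1 hvol, ENNReal.toReal_ofReal]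
    exact intervalIntegral.integral_nonneg ha1 fun y hy => (hvol y hy).1

theorem mul_mem_Icc_of_blue_region {a θ : ℝ}
    (h : (θ ∈ Icc (0 : ℝ) 1 ∧ 0 ≤ a) ∨
      (θ ∈ Ico (-1 : ℝ) 0 ∧ -θ ≤ a ∧ a ≤ -1 / θ)) :
    ∀ t ∈ Icc (-a) 1, θ * t ∈ Icc (-a) 1 := by
  rintro t ⟨ht, ht'⟩
  rcases h with ⟨⟨h0, h1⟩, ha⟩ | ⟨⟨h1, h0⟩, ha, ha'⟩
  · constructor <;> nlinarith
  · rw [le_div_iff_of_neg h0] at ha'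
    constructor <;> nlinarith

theorem blue_region_recursion (a θ : ℝ)
    (h : (θ ∈ Icc (0 : ℝ) 1 ∧ 0 ≤ a) ∨
      (θ ∈ Ico (-1 : ℝ) 0 ∧ -θ ≤ a ∧ a ≤ -1 / θ)) :
    ∀ n : ℕ, 1 ≤ n →
      persprob a θ n =
        (∑ k ∈ Finset.Icc 1 n,
            ((-1 : ℝ) ^ (k - 1) / k.factorial) * θ ^ (k * (k - 1) / 2) *
              ((1 + a) ^ k)⁻¹ * persprob a θ (n - k)) +
          ((1 + a) ^ (n + 1))⁻¹ * (-1) ^ n * θ ^ (n * (n + 1) / 2) *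
            (1 - (-a) ^ (n + 1)) / (n + 1).factorial := by
  have ha : 0 ≤ a := by
    rcases h with ⟨_, ha⟩ | ⟨hθ, ha, _⟩
    · exact ha
    · linarith [hθ.2]
  have ha' : 1 + a ≠ 0 := by positivity
  have hp := persprob_eq_integral ha (mul_mem_Icc_of_blue_region h)
  intro n hn
  obtain ⟨m, rfl⟩ := Nat.exists_eq_add_of_le' hn
  have hIcc : Finset.Icc 1 (m + 1) = Finset.Ico (0 + 1) (m + 1 + 1) := by
    ext k
    simp only [Finset.mem_Icc, Finset.mem_Ico]
    omega
  rw [hp, integral_iterInt_succ, add_div, Finset.sum_div,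
    Finset.Nat.sum_antidiagonal_eq_sum_range_succ_mk, Finset.range_eq_Ico, hIcc,
    ← Finset.sum_Ico_add']
  congr 1
  · refine Finset.sum_congr rfl fun k hk => ?_
    have hkm : k ≤ m := Nat.lt_succ_iff.1 (Finset.mem_Ico.1 hk).2
    have hpow : (1 + a) ^ (m + 1 + 1) = (1 + a) ^ (k + 1) * (1 + a) ^ (m - k + 1) := by
      rw [← pow_add]
      congr 1
      omega
    rw [Nat.add_sub_cancel, Nat.add_sub_add_right, hp, hpow, qExpCoeff, Nat.factorial_succ,
      mul_comm (k + 1) k]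
    push_cast
    field_simp
  · rw [qExpCoeff, Nat.factorial_succ (m + 1)]
    push_cast
    have hm : (m : ℝ) + 2 ≠ 0 := by positivity
    have hm' : (m : ℝ) + 1 + 1 ≠ 0 := by positivity
    field_simp
    ring
end
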